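/- Concentration of the cut-off log-determinant: There exist constants K₁, K₂ > 0 (independent of y) such that for all n, all y ∈ ℝ^m, and all t > 0, P_z[ (1/n)| Σ_{i=1}^{n−1} ln_{ε_n}|λ_i(H̃_n^Λ(y))| − E_z Σ_{i=1}^{n−1} ln_{ε_n}|λ_i(H̃_n^Λ(y))| | ≥ t ] ≤ K₁ exp(−K₂ n^{2−γ−2δ} t²). -/

import Mathlib

/- STATEMENT 13: Gaussian (Herbst) concentration of the cut-off log-determinant
(Proposition A.11 of the paper): with ε_n = n^{−δ}, there are K₁, K₂ > 0 independent of
y such that for all n, y and t > 0,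
 P_z[ (1/n)|∑_i ln_{ε_n}|λ_i(H̃_n^Λ(y))| − E_z ∑_i ln_{ε_n}|λ_i(H̃_n^Λ(y))|| ≥ t ]
   ≤ K₁ exp(−K₂ n^{2−γ−2δ} t²). -/


open MeasureTheory Matrix Filter Topology Real Set ProbabilityTheory
open scoped ENNReal NNReal Classical

noncomputable section

abbrev stdGauss : Measure ℝ := gaussianReal 0 1

def gaussVec (k : ℕ) : Measure (Fin k → ℝ) := Measure.pi fun _ => stdGauss

def gaussMat (a b : ℕ) : Measure (Fin a → Fin b → ℝ) :=
  Measure.pi fun _ => Measure.pi fun _ => stdGauss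

def Pperp (φ : ℝ → ℝ) {m : ℕ} (y : Fin m → ℝ) : Matrix (Fin m) (Fin m) ℝ :=
  1 - Matrix.of (fun μ ν => deriv φ (y μ) * deriv φ (y ν) / ∑ ρ, (deriv φ (y ρ)) ^ 2)

def Dmat (φ : ℝ → ℝ) (n : ℕ) {m : ℕ} (y : Fin m → ℝ) : Matrix (Fin m) (Fin m) ℝ :=
  Matrix.diagonal fun μ => ((n : ℝ) / m) * deriv (deriv φ) (y μ)

def Lam (φ : ℝ → ℝ) (n : ℕ) {m : ℕ} (y : Fin m → ℝ) : Matrix (Fin m) (Fin m) ℝ :=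
  Pperp φ y * Dmat φ n y * Pperp φ y

def Hmat (φ : ℝ → ℝ) (n : ℕ) {m : ℕ} (y : Fin m → ℝ)
    (z : Fin (n - 1) → Fin m → ℝ) : Matrix (Fin (n - 1)) (Fin (n - 1)) ℝ :=
  ((n : ℝ)⁻¹) • (Matrix.of z * Lam φ n y * (Matrix.of z)ᵀ) -
    ((1 / (m : ℝ)) * ∑ μ, y μ * deriv φ (y μ)) • 1

/-- `E_z |det H_n^Λ(y)|`. -/
def Edet (φ : ℝ → ℝ) (n m : ℕ) (y : Fin m → ℝ) : ℝ :=
  ∫ z, |Matrix.det (Hmat φ n y z)| ∂(gaussMat (n - 1) m)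


/-- Eigenvalues of a (Hermitian) real matrix; junk value `0` otherwise. -/
def eigs {k : ℕ} (M : Matrix (Fin k) (Fin k) ℝ) : Fin k → ℝ :=
  if h : M.IsHermitian then h.eigenvalues else 0

/-- `Tr f(M) = ∑_i f(λ_i(M))`. -/
def trF {k : ℕ} (f : ℝ → ℝ) (M : Matrix (Fin k) (Fin k) ℝ) : ℝ :=
  ∑ i, f (eigs M i)

/-- The truncation normalizer `E[z² 1{|z| ≤ c}]`. -/
def truncNorm (c : ℝ) : ℝ := ∫ x in {x : ℝ | |x| ≤ c}, x ^ 2 ∂stdGauss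

/-- Truncated and renormalized entry `z̃ = z 1{|z| ≤ c} / (E[z² 1{|z| ≤ c}])^{1/2}`. -/
def trunc (c v : ℝ) : ℝ := (if |v| ≤ c then v else 0) / Real.sqrt (truncNorm c)


/-- `ln_ε |x| = ln (max (|x|, ε))`. -/
def lnEps (ε x : ℝ) : ℝ := Real.log (max |x| ε)


/-- `∑_i ln_{ε}|λ_i(H̃_n^Λ(y))|` as a function of the (untruncated) Gaussian entries. -/
def cutoffLogDet (φ : ℝ → ℝ) (n : ℕ) {m : ℕ} (γ δ : ℝ) (y : Fin m → ℝ)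
    (z : Fin (n - 1) → Fin m → ℝ) : ℝ :=
  ∑ i, lnEps ((n : ℝ) ^ (-δ))
    (eigs (Hmat φ n y (fun i μ => trunc ((n : ℝ) ^ (γ / 2)) (z i μ))) i)

section GaussianConcentration

lemma pi_gaussianReal_absolutelyContinuous (d : ℕ) :
    Measure.pi (fun _ : Fin d => gaussianReal 0 1) ≪ (volume : Measure (Fin d → ℝ)) := by
  induction d with
  | zero =>
    intro s hs
    rw [volume_pi, Measure.pi_of_empty] at hs
    rwa [Measure.pi_of_empty]
  | succ d ih =>
    have h1 := (measurePreserving_piFinSuccAbove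
      (fun _ : Fin (d + 1) => gaussianReal 0 1) 0).symm
    have h2 := (volume_preserving_piFinSuccAbove (fun _ : Fin (d + 1) => ℝ) 0).symm
    rw [← h1.map_eq, ← h2.map_eq]
    exact ((gaussianReal_absolutelyContinuous 0 one_ne_zero).prod ih).map h1.measurable

variable {E : Type*} [NormedAddCommGroup E] [InnerProductSpace ℝ E] [FiniteDimensional ℝ E]
  [MeasurableSpace E] [BorelSpace E]

lemma ae_differentiableAt_stdGaussian {K : ℝ≥0} {f : E → ℝ} (hf : LipschitzWith K f) :
    ∀ᵐ x ∂stdGaussian E, DifferentiableAt ℝ f x := by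
  let e : (Fin (Module.finrank ℝ E) → ℝ) ≃L[ℝ] E :=
    (stdOrthonormalBasis ℝ E).toBasis.equivFun.symm.toContinuousLinearEquiv
  have he : stdGaussian E =
      (Measure.pi (fun _ : Fin (Module.finrank ℝ E) ↦ gaussianReal 0 1)).map e := by
    rw [stdGaussian]
    congr 1
    ext x
    simp [e, OrthonormalBasis.sum_repr_symm]
  have hac : stdGaussian E ≪ (volume : Measure (Fin (Module.finrank ℝ E) → ℝ)).map e := by
    rw [he]
    exact (pi_gaussianReal_absolutelyContinuous _).map e.continuous.measurable
  exact hac.ae_le (hf.ae_differentiableAt (μ := volume.map e))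

lemma integrable_exp_mul_norm_stdGaussian (c : ℝ) :
    Integrable (fun x => Real.exp (c * ‖x‖)) (stdGaussian E) := by
  obtain ⟨C, hC, hint⟩ := IsGaussian.exists_integrable_exp_sq (stdGaussian E)
  refine (hint.const_mul (Real.exp (c ^ 2 / (4 * C)))).mono' (by fun_prop) (.of_forall fun x => ?_)
  rw [Real.norm_eq_abs, Real.abs_exp, ← Real.exp_add]
  refine Real.exp_le_exp.2 ?_
  have : c ^ 2 / (4 * C) + C * ‖x‖ ^ 2 - c * ‖x‖ = C * (‖x‖ - c / (2 * C)) ^ 2 := by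
    field_simp
    ring
  nlinarith [mul_nonneg hC.le (sq_nonneg (‖x‖ - c / (2 * C)))]

lemma integral_exp_dual_stdGaussian (L : StrongDual ℝ E) :
    ∫ x, Real.exp (L x) ∂stdGaussian E = Real.exp (‖L‖ ^ 2 / 2) := by
  have h := mgf_gaussianReal (IsGaussian.map_eq_gaussianReal (μ := stdGaussian E) L) 1
  rw [variance_dual_stdGaussian, integral_strongDual_stdGaussian] at h
  simpa [mgf] using h

omit [FiniteDimensional ℝ E] [MeasurableSpace E] [BorelSpace E] in
lemma norm_rotation_sub_le {h : ℝ} (h0 : 0 ≤ h) (h2 : h ≤ 2) (x y : E) :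
    ‖Real.cos h • x + Real.sin h • y - x‖ ≤ h * (‖x‖ + ‖y‖) := by
  have e : Real.cos h • x + Real.sin h • y - x = (Real.cos h - 1) • x + Real.sin h • y := by
    module
  have hc : |Real.cos h - 1| ≤ h := by
    rw [abs_le]
    constructor <;> nlinarith [Real.one_sub_sq_div_two_le_cos (x := h), Real.cos_le_one h]
  have hs : |Real.sin h| ≤ h := by simpa [abs_of_nonneg h0] using Real.abs_sin_le_abs (x := h)
  rw [e]
  calc _ ≤ ‖(Real.cos h - 1) • x‖ + ‖Real.sin h • y‖ := norm_add_le _ _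
    _ ≤ h * ‖x‖ + h * ‖y‖ := by
      rw [norm_smul, norm_smul, Real.norm_eq_abs, Real.norm_eq_abs]
      gcongr
    _ = _ := by ring

lemma integrable_exp_mul_norm_add_norm (c : ℝ) :
    Integrable (fun p : E × E => Real.exp (c * (‖p.1‖ + ‖p.2‖)))
      ((stdGaussian E).prod (stdGaussian E)) := by
  simp_rw [mul_add, Real.exp_add]
  exact (integrable_exp_mul_norm_stdGaussian c).mul_prod (integrable_exp_mul_norm_stdGaussian c)

lemma integrable_exp_of_abs_le {g : E × E → ℝ} (hg : Continuous g) (c : ℝ)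
    (h : ∀ p, |g p| ≤ c * (‖p.1‖ + ‖p.2‖)) :
    Integrable (fun p => Real.exp (g p)) ((stdGaussian E).prod (stdGaussian E)) := by
  refine (integrable_exp_mul_norm_add_norm c).mono' (by fun_prop) (.of_forall fun p => ?_)
  rw [Real.norm_eq_abs, Real.abs_exp]
  exact Real.exp_le_exp.2 ((le_abs_self _).trans (h p))

omit [FiniteDimensional ℝ E] [MeasurableSpace E] [BorelSpace E] in
lemma abs_mul_rotation_increment_le {K : ℝ≥0} {f : E → ℝ} (hf : LipschitzWith K f) {M : ℕ}
    (hM : 0 < M) (p : E × E) :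
    |M * (f (Real.cos (π / 2 / M) • p.1 + Real.sin (π / 2 / M) • p.2) - f p.1)| ≤
      (π / 2 * K) * (‖p.1‖ + ‖p.2‖) := by
  have hM' : (1 : ℝ) ≤ M := by exact_mod_cast hM
  have h2 : π / 2 / M ≤ 2 := by
    rw [div_le_iff₀ (by linarith)]
    nlinarith [Real.pi_le_four]
  have h1 := norm_rotation_sub_le (by positivity) h2 p.1 p.2
  have h3 := hf.dist_le_mul (Real.cos (π / 2 / M) • p.1 + Real.sin (π / 2 / M) • p.2) p.1
  rw [Real.dist_eq, dist_eq_norm] at h3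
  rw [abs_mul, Nat.abs_cast]
  calc _ ≤ (M : ℝ) * (K * (π / 2 / M * (‖p.1‖ + ‖p.2‖))) := by gcongr; exact h3.trans (by gcongr)
    _ = _ := by field_simp

/-- Splitting a quarter turn into `M` equal rotations and applying Jensen's inequality. -/
lemma integral_exp_sub_le_step {K : ℝ≥0} {f : E → ℝ} (hf : LipschitzWith K f) {M : ℕ}
    (hM : 0 < M) :
    ∫ p, Real.exp (f p.2 - f p.1) ∂(stdGaussian E).prod (stdGaussian E) ≤
      ∫ p, Real.exp (M * (f (Real.cos (π / 2 / M) • p.1 + Real.sin (π / 2 / M) • p.2) - f p.1))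
        ∂(stdGaussian E).prod (stdGaussian E) := by
  have hfc := hf.continuous
  have hM' : (0 : ℝ) < M := by exact_mod_cast hM
  set h : ℝ := π / 2 / M with hh
  set G : E × E → ℝ := fun p => Real.exp (M * (f (Real.cos h • p.1 + Real.sin h • p.2) - f p.1))
    with hG
  have hGc : Continuous G := by fun_prop
  have hGi : Integrable G ((stdGaussian E).prod (stdGaussian E)) :=
    integrable_exp_of_abs_le (by fun_prop) _ (abs_mul_rotation_increment_le hf hM)
  let γ : ℕ → E × E → E := fun k p => Real.cos (k * h) • p.1 + Real.sin (k * h) • p.2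
  have hrot (θ : ℝ) := IsGaussian.map_rotation_eq_self (μ := stdGaussian E) (by simp) θ
  have hγ (k : ℕ) (p : E × E) : G (ContinuousLinearMap.rotation (k * h) p) =
      Real.exp (M * (f (γ (k + 1) p) - f (γ k p))) := by
    simp only [hG, ContinuousLinearMap.rotation_apply, γ]
    congr 4
    rw [Nat.cast_add_one, add_mul, one_mul, Real.cos_add, Real.sin_add]
    module
  have hint (k : ℕ) : Integrable (fun p => Real.exp (M * (f (γ (k + 1) p) - f (γ k p))))
      ((stdGaussian E).prod (stdGaussian E)) := by
    simp_rw [← hγ]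
    exact (integrable_map_measure (by rw [hrot]; exact hGc.aestronglyMeasurable)
      (ContinuousLinearMap.rotation (k * h)).continuous.aemeasurable).1 (by rwa [hrot])
  have heq (k : ℕ) : ∫ p, Real.exp (M * (f (γ (k + 1) p) - f (γ k p)))
      ∂(stdGaussian E).prod (stdGaussian E) = ∫ p, G p ∂(stdGaussian E).prod (stdGaussian E) := by
    simp_rw [← hγ]
    rw [← integral_map (ContinuousLinearMap.rotation (k * h)).continuous.aemeasurable
      hGc.aestronglyMeasurable, hrot]
  have hpt (p : E × E) : Real.exp (f p.2 - f p.1) ≤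
      ∑ k ∈ Finset.range M, (M : ℝ)⁻¹ * Real.exp (M * (f (γ (k + 1) p) - f (γ k p))) := by
    have hJ := convexOn_exp.map_sum_le (t := Finset.range M) (w := fun _ => (M : ℝ)⁻¹)
      (p := fun k => M * (f (γ (k + 1) p) - f (γ k p))) (fun _ _ => by positivity)
      (by simp [hM'.ne']) (fun _ _ => mem_univ _)
    simp only [smul_eq_mul] at hJ
    have hMh : (M : ℝ) * h = π / 2 := by rw [hh]; field_simp
    have hend : f (γ M p) - f (γ 0 p) = f p.2 - f p.1 := by simp [γ, hMh]
    rwa [Finset.sum_congr rfl fun k _ => inv_mul_cancel_left₀ hM'.ne' _,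
      Finset.sum_range_sub (fun k => f (γ k p)), hend] at hJ
  calc _ ≤ ∫ p, ∑ k ∈ Finset.range M, (M : ℝ)⁻¹ * Real.exp (M * (f (γ (k + 1) p) - f (γ k p)))
        ∂(stdGaussian E).prod (stdGaussian E) := by
        refine integral_mono_of_nonneg (.of_forall fun p => (Real.exp_pos _).le)
          (integrable_finsetSum _ fun k _ => (hint k).const_mul _) (.of_forall hpt)
    _ = _ := by
      rw [integral_finsetSum _ fun k _ => (hint k).const_mul _]
      simp_rw [integral_const_mul, heq]
      simp [hM'.ne']

omit [FiniteDimensional ℝ E] [MeasurableSpace E] [BorelSpace E] in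
lemma hasDerivAt_comp_rotation {f : E → ℝ} {x : E} (hx : DifferentiableAt ℝ f x) (y : E) :
    HasDerivAt (fun t : ℝ => f (Real.cos t • x + Real.sin t • y)) (fderiv ℝ f x y) 0 := by
  have h1 : HasDerivAt (fun t : ℝ => Real.cos t • x + Real.sin t • y) y 0 := by
    have := ((Real.hasDerivAt_cos 0).smul_const x).add ((Real.hasDerivAt_sin 0).smul_const y)
    simpa using! this
  have h2 : HasFDerivAt f (fderiv ℝ f x) (Real.cos 0 • x + Real.sin 0 • y) := by
    simpa using hx.hasFDerivAt
  exact h2.comp_hasDerivAt 0 h1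

/-- The **Maurey–Pisier** exponential inequality for Lipschitz functions. -/
lemma integral_exp_sub_le {K : ℝ≥0} {f : E → ℝ} (hf : LipschitzWith K f) :
    ∫ p, Real.exp (f p.2 - f p.1) ∂(stdGaussian E).prod (stdGaussian E) ≤
      Real.exp (π ^ 2 / 8 * K ^ 2) := by
  have hfc := hf.continuous
  have hae : ∀ᵐ p ∂(stdGaussian E).prod (stdGaussian E), DifferentiableAt ℝ f p.1 :=
    Measure.quasiMeasurePreserving_fst.ae (ae_differentiableAt_stdGaussian hf)
  let g : E × E → ℝ := fun p => π / 2 * fderiv ℝ f p.1 p.2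
  have hlim : ∀ᵐ p ∂(stdGaussian E).prod (stdGaussian E), Tendsto (fun M : ℕ =>
      Real.exp (((M + 1 : ℕ) : ℝ) * (f (Real.cos (π / 2 / (M + 1 : ℕ)) • p.1 +
        Real.sin (π / 2 / (M + 1 : ℕ)) • p.2) - f p.1))) atTop (𝓝 (Real.exp (g p))) := by
    filter_upwards [hae] with p hp
    refine (Real.continuous_exp.tendsto _).comp ?_
    have h1 := (hasDerivAt_comp_rotation hp p.2).tendsto_slope
    have h2 : Tendsto (fun M : ℕ => π / 2 / ((M + 1 : ℕ) : ℝ)) atTop (𝓝[≠] 0) := by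
      refine tendsto_nhdsWithin_iff.2 ⟨?_, .of_forall fun M => ?_⟩
      · exact (tendsto_const_div_atTop_nhds_zero_nat (π / 2)).comp (tendsto_add_atTop_nat 1)
      · have : (0 : ℝ) < π / 2 / ((M + 1 : ℕ) : ℝ) := by positivity
        exact this.ne'
    have h3 := (h1.comp h2).const_mul (π / 2)
    refine h3.congr fun M => ?_
    simp only [Function.comp_apply, slope_def_field, Real.cos_zero, Real.sin_zero, one_smul,
      zero_smul, add_zero, sub_zero]
    have : (((M + 1 : ℕ) : ℝ)) ≠ 0 := by positivity
    field_simp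
  have hgm : AEStronglyMeasurable (fun p => Real.exp (g p))
      ((stdGaussian E).prod (stdGaussian E)) :=
    aestronglyMeasurable_of_tendsto_ae atTop
      (fun M => (by fun_prop : Continuous _).aestronglyMeasurable) hlim
  have hgb (p : E × E) : |g p| ≤ π / 2 * K * (‖p.1‖ + ‖p.2‖) := by
    have h1 := (fderiv ℝ f p.1).le_opNorm p.2
    have h2 := norm_fderiv_le_of_lipschitz ℝ hf (x₀ := p.1)
    rw [Real.norm_eq_abs] at h1
    simp only [g]
    rw [abs_mul, abs_of_pos (by positivity : 0 < π / 2), mul_assoc]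
    gcongr
    calc _ ≤ K * ‖p.2‖ := h1.trans (by gcongr)
      _ ≤ _ := by gcongr; linarith [norm_nonneg p.1]
  have hgi : Integrable (fun p => Real.exp (g p)) ((stdGaussian E).prod (stdGaussian E)) := by
    refine (integrable_exp_mul_norm_add_norm (π / 2 * K)).mono' hgm (.of_forall fun p => ?_)
    rw [Real.norm_eq_abs, Real.abs_exp]
    exact Real.exp_le_exp.2 ((le_abs_self _).trans (hgb p))
  have hT := tendsto_integral_of_dominated_convergence
    (μ := (stdGaussian E).prod (stdGaussian E))
    (fun p : E × E => Real.exp (π / 2 * K * (‖p.1‖ + ‖p.2‖)))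
    (fun M => (by fun_prop : Continuous _).aestronglyMeasurable)
    (integrable_exp_mul_norm_add_norm (π / 2 * K))
    (fun M => .of_forall fun p => by
      rw [Real.norm_eq_abs, Real.abs_exp]
      exact Real.exp_le_exp.2 ((le_abs_self _).trans
        (abs_mul_rotation_increment_le hf M.succ_pos p))) hlim
  refine (ge_of_tendsto' hT fun M => integral_exp_sub_le_step hf M.succ_pos).trans ?_
  rw [integral_prod _ hgi]
  have hx (x : E) : ∫ y, Real.exp (g (x, y)) ∂stdGaussian E ≤ Real.exp (π ^ 2 / 8 * K ^ 2) := by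
    have h1 := integral_exp_dual_stdGaussian ((π / 2) • fderiv ℝ f x)
    have h2 := norm_fderiv_le_of_lipschitz ℝ hf (x₀ := x)
    simp only [FunLike.coe_smul, Pi.smul_apply, smul_eq_mul] at h1
    simp only [g]
    rw [h1, norm_smul, Real.norm_of_nonneg (by positivity)]
    refine Real.exp_le_exp.2 ?_
    calc _ ≤ (π / 2 * K) ^ 2 / 2 := by gcongr
      _ = _ := by ring
  calc _ ≤ ∫ _, Real.exp (π ^ 2 / 8 * K ^ 2) ∂stdGaussian E :=
        integral_mono_of_nonneg (.of_forall fun x => integral_nonneg fun _ => (Real.exp_pos _).le)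
          (integrable_const _) (.of_forall hx)
    _ = _ := by simp

lemma LipschitzWith.integrable_exp_stdGaussian {K : ℝ≥0} {f : E → ℝ} (hf : LipschitzWith K f) :
    Integrable (fun x => Real.exp (f x)) (stdGaussian E) := by
  have hfc := hf.continuous
  refine ((integrable_exp_mul_norm_stdGaussian (K : ℝ)).const_mul (Real.exp (f 0))).mono'
    (by fun_prop) (.of_forall fun x => ?_)
  rw [Real.norm_eq_abs, Real.abs_exp, ← Real.exp_add]
  refine Real.exp_le_exp.2 ?_
  have := hf.dist_le_mul x 0
  rw [Real.dist_eq, dist_zero_right] at this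
  linarith [le_abs_self (f x - f 0)]

lemma LipschitzWith.integrable_stdGaussian {K : ℝ≥0} {f : E → ℝ} (hf : LipschitzWith K f) :
    Integrable f (stdGaussian E) := by
  have h1 := hf.integrable_exp_stdGaussian
  have h2 := hf.neg.integrable_exp_stdGaussian
  refine (h1.add h2).mono' hf.continuous.aestronglyMeasurable (.of_forall fun x => ?_)
  simp only [Pi.add_apply, Pi.neg_apply]
  rw [Real.norm_eq_abs, abs_le]
  constructor <;> nlinarith [Real.add_one_le_exp (f x), Real.add_one_le_exp (-f x),
    Real.exp_pos (f x), Real.exp_pos (-f x)]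

lemma LipschitzWith.integral_exp_sub_integral_le {K : ℝ≥0} {f : E → ℝ}
    (hf : LipschitzWith K f) :
    ∫ x, Real.exp (f x - ∫ y, f y ∂stdGaussian E) ∂stdGaussian E ≤
      Real.exp (π ^ 2 / 8 * K ^ 2) := by
  have h1 : Real.exp (∫ y, -f y ∂stdGaussian E) ≤ ∫ y, Real.exp (-f y) ∂stdGaussian E :=
    convexOn_exp.map_integral_le Real.continuous_exp.continuousOn isClosed_univ
      (.of_forall fun _ => mem_univ _) hf.integrable_stdGaussian.neg
      hf.neg.integrable_exp_stdGaussian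
  have h2 := integral_exp_sub_le hf
  have h3 := integral_prod_mul (μ := stdGaussian E) (ν := stdGaussian E)
    (fun x => Real.exp (-f x)) (fun x => Real.exp (f x))
  simp_rw [← Real.exp_add, neg_add_eq_sub] at h3
  rw [h3] at h2
  rw [integral_neg] at h1
  simp_rw [sub_eq_add_neg, Real.exp_add]
  rw [integral_mul_const]
  refine le_trans ?_ h2
  rw [mul_comm]
  exact mul_le_mul_of_nonneg_right h1 (integral_nonneg fun _ => (Real.exp_pos _).le)

lemma LipschitzWith.hasSubgaussianMGF_stdGaussian {K : ℝ≥0} {f : E → ℝ}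
    (hf : LipschitzWith K f) (c : ℝ≥0) (hc : (c : ℝ) = π ^ 2 / 4 * K ^ 2) :
    HasSubgaussianMGF (fun x => f x - ∫ y, f y ∂stdGaussian E) c (stdGaussian E) where
  integrable_exp_mul t := by
    have h : LipschitzWith (‖t‖₊ * K) fun x => t * (f x - ∫ y, f y ∂stdGaussian E) :=
      .of_dist_le_mul fun x y => by
        have := hf.dist_le_mul x y
        rw [Real.dist_eq] at this ⊢
        rw [← mul_sub, sub_sub_sub_cancel_right, abs_mul, NNReal.coe_mul, coe_nnnorm,
          Real.norm_eq_abs, mul_assoc]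
        gcongr
    exact h.integrable_exp_stdGaussian
  mgf_le t := by
    have h : LipschitzWith (‖t‖₊ * K) fun x => t * f x :=
      .of_dist_le_mul fun x y => by
        have := hf.dist_le_mul x y
        rw [Real.dist_eq] at this ⊢
        rw [← mul_sub, abs_mul, NNReal.coe_mul, coe_nnnorm, Real.norm_eq_abs, mul_assoc]
        gcongr
    have h1 := h.integral_exp_sub_integral_le
    rw [integral_const_mul] at h1
    simp_rw [mgf, mul_sub]
    refine h1.trans_eq ?_
    rw [hc, NNReal.coe_mul, coe_nnnorm, Real.norm_eq_abs, mul_pow, sq_abs]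
    ring_nf

/-- **Gaussian concentration** of Lipschitz functions. -/
theorem LipschitzWith.measure_stdGaussian_abs_sub_integral_ge_le {K : ℝ≥0} {f : E → ℝ}
    (hf : LipschitzWith K f) {r : ℝ} (hr : 0 ≤ r) :
    stdGaussian E {x | r ≤ |f x - ∫ y, f y ∂stdGaussian E|} ≤
      ENNReal.ofReal (2 * Real.exp (-r ^ 2 / (2 * (π ^ 2 / 4 * K ^ 2)))) := by
  have h := hf.hasSubgaussianMGF_stdGaussian (NNReal.pi ^ 2 / 4 * K ^ 2) (by simp)
  have h1 := h.measure_ge_le hr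
  have h2 := h.neg.measure_ge_le hr
  have hs : {x | r ≤ |f x - ∫ y, f y ∂stdGaussian E|} ⊆
      {x | r ≤ f x - ∫ y, f y ∂stdGaussian E} ∪
        {x | r ≤ (-fun x => f x - ∫ y, f y ∂stdGaussian E) x} := by
    intro x hx
    simp only [Set.mem_ofPred_eq, Set.mem_union, Pi.neg_apply] at hx ⊢
    exact le_abs.1 hx
  have hreal := (measureReal_mono (μ := stdGaussian E) hs).trans (measureReal_union_le _ _)
  rw [← ofReal_measureReal]
  refine ENNReal.ofReal_le_ofReal (hreal.trans ((add_le_add h1 h2).trans_eq ?_))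
  simp only [NNReal.coe_mul, NNReal.coe_div, NNReal.coe_pow, NNReal.coe_real_pi,
    NNReal.coe_ofNat]
  ring

end GaussianConcentration
section TruncatedGaussian

lemma hasDerivAt_cdf_stdGauss (x : ℝ) :
    HasDerivAt (cdf stdGauss) (gaussianPDFReal 0 1 x) x := by
  have hc : Continuous (gaussianPDFReal 0 1) := by
    rw [gaussianPDFReal_def]
    fun_prop
  have hi (s : Set ℝ) : IntegrableOn (gaussianPDFReal 0 1) s :=
    (integrable_gaussianPDFReal 0 1).integrableOn
  have hcdf (u : ℝ) : cdf stdGauss u = ∫ t in Iic u, gaussianPDFReal 0 1 t := by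
    rw [cdf_eq_real, measureReal_def, gaussianReal_apply_eq_integral 0 one_ne_zero,
      ENNReal.toReal_ofReal (integral_nonneg fun t => gaussianPDFReal_nonneg _ _ _)]
  have h : (cdf stdGauss : ℝ → ℝ) =
      fun u => cdf stdGauss 0 + ∫ t in (0 : ℝ)..u, gaussianPDFReal 0 1 t := by
    ext u
    rw [← intervalIntegral.integral_Iic_sub_Iic (hi _) (hi _), hcdf, hcdf]
    ring
  rw [h]
  exact (hc.integral_hasStrictDerivAt 0 x).hasDerivAt.const_add _

lemma continuous_cdf_stdGauss : Continuous (cdf stdGauss) :=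
  continuous_iff_continuousAt.2 fun x => (hasDerivAt_cdf_stdGauss x).continuousAt

lemma strictMono_cdf_stdGauss : StrictMono (cdf stdGauss) :=
  strictMono_of_deriv_pos fun x => by
    rw [(hasDerivAt_cdf_stdGauss x).deriv]
    exact gaussianPDFReal_pos _ _ _ one_ne_zero

instance nullSingletonClass_stdGauss : NullSingletonClass stdGauss :=
  nullSingletonClass_gaussianReal one_ne_zero

lemma cdf_stdGauss_neg (x : ℝ) : cdf stdGauss (-x) = 1 - cdf stdGauss x := by
  have h1 : stdGauss.map (fun x => -x) = stdGauss := by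
    simpa using! gaussianReal_map_neg (μ := 0) (v := 1)
  rw [cdf_eq_real, cdf_eq_real, ← probReal_compl_eq_one_sub measurableSet_Iic, compl_Iic,
    ← measureReal_congr (Ioi_ae_eq_Ici (μ := stdGauss) (a := x)).symm]
  conv_lhs => rw [← h1]
  rw [map_measureReal_apply measurable_neg measurableSet_Iic]
  congr 1
  ext y
  simp

lemma cdf_stdGauss_zero : cdf stdGauss 0 = 1 / 2 := by
  have := cdf_stdGauss_neg 0
  rw [neg_zero] at this
  linarith

lemma cdf_stdGauss_increment_le {s x d : ℝ} (hs : 0 ≤ s) (hsx : s ≤ x) (hd : 0 ≤ d) :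
    cdf stdGauss (x + d) - cdf stdGauss x ≤ cdf stdGauss (s + d) - cdf stdGauss s := by
  have hder (u : ℝ) : HasDerivAt (fun u => cdf stdGauss (u + d) - cdf stdGauss u)
      (gaussianPDFReal 0 1 (u + d) - gaussianPDFReal 0 1 u) u := by
    have h1 : HasDerivAt (fun u => cdf stdGauss (u + d)) (gaussianPDFReal 0 1 (u + d)) u :=
      (hasDerivAt_cdf_stdGauss (u + d)).comp_add_const u d
    exact h1.sub (hasDerivAt_cdf_stdGauss u)
  have hanti : AntitoneOn (fun u => cdf stdGauss (u + d) - cdf stdGauss u) (Ici 0) := by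
    refine antitoneOn_of_deriv_nonpos (convex_Ici 0)
      (fun u _ => (hder u).continuousAt.continuousWithinAt)
      (fun u _ => (hder u).differentiableAt.differentiableWithinAt) fun u hu => ?_
    rw [interior_Ici, Set.mem_Ioi] at hu
    rw [(hder u).deriv, gaussianPDFReal_def, sub_nonpos]
    have : u ^ 2 ≤ (u + d) ^ 2 := by gcongr; linarith
    simp only [sub_zero]
    gcongr
  exact hanti hs (hs.trans hsx) hsx

lemma measureReal_cdf_stdGauss_le {u : ℝ} (h0 : 0 ≤ u) (h1 : u ≤ 1) :
    stdGauss.real {x | cdf stdGauss x ≤ u} = u := by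
  have hpos (x : ℝ) : 0 < cdf stdGauss x :=
    (cdf_nonneg _ (x - 1)).trans_lt (strictMono_cdf_stdGauss (by linarith))
  rcases h0.eq_or_lt with rfl | h0
  · have : {x | cdf stdGauss x ≤ 0} = ∅ := by
      ext x
      simp [hpos x]
    rw [this, measureReal_empty]
  rcases h1.eq_or_lt with rfl | h1
  · have : {x | cdf stdGauss x ≤ 1} = univ := by
      ext x
      simp [cdf_le_one]
    rw [this, probReal_univ]
  obtain ⟨x, rfl⟩ : u ∈ range (cdf stdGauss) := by
    refine mem_range_of_exists_le_of_exists_ge continuous_cdf_stdGauss ?_ ?_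
    · exact ((tendsto_cdf_atBot stdGauss).eventually_le_const h0).exists
    · exact ((tendsto_cdf_atTop stdGauss).eventually_const_le h1).exists
  simp_rw [strictMono_cdf_stdGauss.le_iff_le]
  exact (cdf_eq_real stdGauss x).symm

/-- The truncation `v 1{|v| ≤ c}` without renormalization. -/
def hardCut (c v : ℝ) : ℝ := if |v| ≤ c then v else 0

lemma abs_hardCut_le {c : ℝ} (hc : 0 ≤ c) (v : ℝ) : |hardCut c v| ≤ c := by
  unfold hardCut
  split_ifs with h
  · exact h
  · simpa using hc

lemma measurable_hardCut (c : ℝ) : Measurable (hardCut c) :=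
  Measurable.ite (measurableSet_le (by fun_prop) (by fun_prop)) measurable_id measurable_const

/-- The value of the standard Gaussian distribution function at the increasing rearrangement of
the truncated Gaussian, when each tail has mass `q`. -/
def cutLevel (q x : ℝ) : ℝ :=
  max (cdf stdGauss x - q) (min (cdf stdGauss x + q) (1 / 2))

lemma cutLevel_neg (q x : ℝ) (hq : 0 ≤ q) : cutLevel q (-x) = 1 - cutLevel q x := by
  unfold cutLevel
  rw [cdf_stdGauss_neg]
  simp only [max_def, min_def]
  split_ifs <;> linarith

lemma cutLevel_mono (q : ℝ) : Monotone (cutLevel q) := fun x y hxy => by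
  unfold cutLevel
  have := monotone_cdf stdGauss hxy
  gcongr

lemma cutLevel_sub_le {q x y : ℝ} (hxy : x ≤ y) :
    cutLevel q y - cutLevel q x ≤ cdf stdGauss y - cdf stdGauss x := by
  unfold cutLevel
  have := monotone_cdf stdGauss hxy
  simp only [max_def, min_def]
  split_ifs <;> linarith

lemma cutLevel_le_cdf {q x : ℝ} (hq : 0 ≤ q) (hx : 0 ≤ x) : cutLevel q x ≤ cdf stdGauss x := by
  have h := monotone_cdf stdGauss hx
  rw [cdf_stdGauss_zero] at h
  unfold cutLevel
  simp only [max_def, min_def]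
  split_ifs <;> linarith

lemma measureReal_hardCut_le {c a : ℝ} (ha : -c ≤ a) (ha' : a < c) :
    stdGauss.real {v | hardCut c v ≤ a} =
      if a < 0 then cdf stdGauss a - cdf stdGauss (-c) else cdf stdGauss a + cdf stdGauss (-c) := by
  have hIoc {u v : ℝ} (h : u ≤ v) : stdGauss.real (Ioc u v) = cdf stdGauss v - cdf stdGauss u := by
    rw [cdf_eq_real, cdf_eq_real, ← measureReal_sdiff (Iic_subset_Iic.2 h) measurableSet_Iic]
    congr 1
    ext
    simp [and_comm]
  split_ifs with h0
  · rw [← hIoc ha, measureReal_congr (Ioc_ae_eq_Icc (μ := stdGauss))]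
    congr 1
    ext v
    simp only [hardCut, Set.mem_ofPred_eq, Set.mem_Icc]
    split_ifs with h
    · exact ⟨fun hv => ⟨(abs_le.1 h).1, hv⟩, fun hv => hv.2⟩
    · refine ⟨fun hv => absurd hv (not_le.2 h0), fun hv => absurd (abs_le.2 ⟨hv.1, ?_⟩) h⟩
      linarith [hv.2]
  · have : {v | hardCut c v ≤ a} = (Ioc a c)ᶜ := by
      ext v
      simp only [hardCut, Set.mem_ofPred_eq, Set.mem_compl_iff, Set.mem_Ioc, not_and]
      split_ifs with h
      · refine ⟨fun hv hv' => absurd hv (not_le.2 hv'), fun hv => ?_⟩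
        by_contra! hv'
        exact hv hv' (abs_le.1 h).2
      · refine ⟨fun _ hv hvc => h (abs_le.2 ⟨by linarith, hvc⟩), fun _ => not_lt.1 h0⟩
    rw [this, probReal_compl_eq_one_sub measurableSet_Ioc, hIoc ha'.le, cdf_stdGauss_neg]
    ring

/-- The truncated Gaussian is the image of the Gaussian under a contraction. -/
lemma exists_lipschitz_map_eq_hardCut {c : ℝ} (hc : 0 < c) :
    ∃ T : ℝ → ℝ, LipschitzWith 1 T ∧ (∀ x, |T x| ≤ c) ∧
      stdGauss.map T = stdGauss.map (hardCut c) := by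
  set q := cdf stdGauss (-c) with hq
  have hq0 : 0 ≤ q := cdf_nonneg _ _
  have hqc : cdf stdGauss c = 1 - q := by rw [hq, cdf_stdGauss_neg]; ring
  have hlt := strictMono_cdf_stdGauss (show -c < 0 by linarith)
  rw [← hq, cdf_stdGauss_zero] at hlt
  have hex (x : ℝ) : ∃ s ∈ Icc (-c) c, cdf stdGauss s = cutLevel q x := by
    refine intermediate_value_Icc (by linarith) continuous_cdf_stdGauss.continuousOn ?_
    rw [← hq, hqc]
    unfold cutLevel
    have h1 := cdf_nonneg stdGauss x
    have h2 := cdf_le_one stdGauss x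
    simp only [max_def, min_def]
    constructor <;> split_ifs <;> linarith
  choose T hTc hT using hex
  have hTmono : Monotone T := fun x y hxy => by
    rw [← strictMono_cdf_stdGauss.le_iff_le, hT, hT]
    exact cutLevel_mono q hxy
  have hTneg (x : ℝ) : T (-x) = -T x := by
    apply strictMono_cdf_stdGauss.injective
    rw [hT, cutLevel_neg q x hq0, cdf_stdGauss_neg, hT]
  have hT0 : T 0 = 0 := by
    have := hTneg 0
    rw [neg_zero] at this
    linarith
  have hstep {x y : ℝ} (hx : 0 ≤ x) (hxy : x ≤ y) : T y - T x ≤ y - x := by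
    have h0 : 0 ≤ T x := hT0 ▸ hTmono hx
    have h1 : T x ≤ x := by
      rw [← strictMono_cdf_stdGauss.le_iff_le, hT]
      exact cutLevel_le_cdf hq0 hx
    by_contra! h
    have h2 := cdf_stdGauss_increment_le h0 h1 (sub_nonneg.2 hxy)
    have h3 := strictMono_cdf_stdGauss (show T x + (y - x) < T y by linarith)
    have h4 := cutLevel_sub_le (q := q) hxy
    rw [← hT, ← hT] at h4
    rw [add_sub_cancel] at h2
    linarith
  have hstep' {x y : ℝ} (hxy : x ≤ y) : T y - T x ≤ y - x := by
    rcases le_total 0 x with hx | hx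
    · exact hstep hx hxy
    rcases le_total 0 y with hy | hy
    · have h1 := hstep le_rfl hy
      have h2 := hstep le_rfl (neg_nonneg.2 hx)
      rw [hTneg] at h2
      linarith
    · have h1 := hstep (neg_nonneg.2 hy) (neg_le_neg hxy)
      rw [hTneg, hTneg] at h1
      linarith
  have hLip : LipschitzWith 1 T := .of_dist_le_mul fun x y => by
    rw [Real.dist_eq, Real.dist_eq, NNReal.coe_one, one_mul]
    rcases le_total x y with h | h
    · rw [abs_sub_comm, abs_sub_comm x, abs_of_nonneg (sub_nonneg.2 (hTmono h)),
        abs_of_nonneg (sub_nonneg.2 h)]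
      exact hstep' h
    · rw [abs_of_nonneg (sub_nonneg.2 (hTmono h)), abs_of_nonneg (sub_nonneg.2 h)]
      exact hstep' h
  refine ⟨T, hLip, fun x => abs_le.2 (hTc x), ?_⟩
  have := Measure.isProbabilityMeasure_map (μ := stdGauss) hLip.continuous.measurable.aemeasurable
  refine Measure.ext_of_Iic _ _ fun a => ?_
  rw [Measure.map_apply hLip.continuous.measurable measurableSet_Iic,
    Measure.map_apply (measurable_hardCut c) measurableSet_Iic]
  change stdGauss {x | T x ≤ a} = stdGauss {v | hardCut c v ≤ a}
  rcases lt_or_ge a (-c) with ha | ha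
  · congr 1
    ext x
    have h1 := (hTc x).1
    have h2 := (abs_le.1 (abs_hardCut_le hc.le x)).1
    simp only [Set.mem_ofPred_eq]
    constructor <;> intro <;> linarith
  rcases lt_or_ge a c with ha' | ha'
  · rw [← measureReal_eq_measureReal_iff, measureReal_hardCut_le ha ha', ← hq]
    have hset : {x | T x ≤ a} =
        {x | cdf stdGauss x ≤ if a < 0 then cdf stdGauss a - q else cdf stdGauss a + q} := by
      ext x
      simp only [Set.mem_ofPred_eq]
      rw [← strictMono_cdf_stdGauss.le_iff_le, hT, cutLevel]
      split_ifs with h0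
      · have := strictMono_cdf_stdGauss h0
        rw [cdf_stdGauss_zero] at this
        simp only [max_def, min_def]
        constructor <;> intro h <;> split_ifs at * <;> linarith
      · have := monotone_cdf stdGauss (not_lt.1 h0)
        rw [cdf_stdGauss_zero] at this
        simp only [max_def, min_def]
        constructor <;> intro h <;> split_ifs at * <;> linarith
    have hqa := monotone_cdf stdGauss ha
    have hac := monotone_cdf stdGauss ha'.le
    rw [← hq] at hqa
    rw [hqc] at hac
    rw [hset, measureReal_cdf_stdGauss_le] <;> split_ifs <;>
      linarith [cdf_nonneg stdGauss a, cdf_le_one stdGauss a]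
  · congr 1
    ext x
    have h1 := (hTc x).2
    have h2 := (abs_le.1 (abs_hardCut_le hc.le x)).2
    simp only [Set.mem_ofPred_eq]
    constructor <;> intro <;> linarith

end TruncatedGaussian
section SpectralPerturbation

lemma log_ge_of_half_le {u : ℝ} (hu : 1 / 2 ≤ u) : u - 1 - 2 * (u - 1) ^ 2 ≤ Real.log u := by
  have h := one_sub_inv_le_log_of_pos (show 0 < u by linarith)
  have h2 : u⁻¹ ≤ 2 := by
    rw [inv_le_comm₀ (by linarith) two_pos]
    linarith
  have h3 : 1 - u⁻¹ = u - 1 - (u - 1) ^ 2 * u⁻¹ := by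
    have : u ≠ 0 := by linarith
    field_simp
    ring
  nlinarith [sq_nonneg (u - 1)]

/-- The cut-off logarithm admits quadratic lower supports with slope at most `ε⁻¹`. -/
lemma exists_lnEps_support {ε : ℝ} (hε : 0 < ε) (b : ℝ) :
    ∃ d : ℝ, |d| ≤ ε⁻¹ ∧ ∀ a : ℝ,
      d * (a - b) - 4 / ε ^ 2 * (a - b) ^ 2 ≤ lnEps ε a - lnEps ε b := by
  rcases le_or_gt |b| ε with hb | hb
  · refine ⟨0, by simpa using hε.le, fun a => ?_⟩
    have h1 : lnEps ε b = Real.log ε := by rw [lnEps, max_eq_right hb]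
    have h2 : Real.log ε ≤ lnEps ε a := Real.log_le_log hε (le_max_right _ _)
    have h3 : 0 ≤ 4 / ε ^ 2 * (a - b) ^ 2 := by positivity
    linarith
  have hb0 : b ≠ 0 := by
    rintro rfl
    rw [abs_zero] at hb
    linarith
  have hb' : 0 < |b| := abs_pos.2 hb0
  refine ⟨b⁻¹, ?_, fun a => ?_⟩
  · rw [abs_inv]
    gcongr
  obtain ⟨u, rfl⟩ : ∃ u, a = u * b := ⟨a / b, by field_simp⟩
  have h1 : lnEps ε b = Real.log |b| := by rw [lnEps, max_eq_left hb.le]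
  have h2 : b⁻¹ * (u * b - b) = u - 1 := by field_simp
  have hs : 1 ≤ |b| / ε := by rw [one_le_div hε]; exact hb.le
  have h3 : 4 / ε ^ 2 * (u * b - b) ^ 2 = 4 * (|b| / ε) ^ 2 * (u - 1) ^ 2 := by
    rw [div_pow, sq_abs]
    ring
  rw [h1, h2, h3]
  set s := |b| / ε with hsdef
  have hss : 1 ≤ s ^ 2 := one_le_pow₀ hs
  rcases le_or_gt (1 / 2) u with hu | hu
  · have h4 : Real.log u + Real.log |b| ≤ lnEps ε (u * b) := by
      rw [← Real.log_mul (by linarith) hb'.ne']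
      refine Real.log_le_log (by positivity) (le_max_of_le_left ?_)
      rw [abs_mul, abs_of_pos (by linarith : 0 < u)]
    have h5 := log_ge_of_half_le hu
    nlinarith [sq_nonneg (u - 1)]
  · have h4 : Real.log ε ≤ lnEps ε (u * b) := Real.log_le_log hε (le_max_right _ _)
    have h5 : Real.log |b| - Real.log ε = Real.log s := by rw [← Real.log_div hb'.ne' hε.ne']
    have h6 := Real.log_le_sub_one_of_pos (show 0 < s by linarith)
    have h7 : 1 / 4 ≤ (u - 1) ^ 2 := by nlinarith
    nlinarith

variable {ι κ E : Type*} [Fintype ι] [Fintype κ] [NormedAddCommGroup E] [InnerProductSpace ℝ E]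

lemma sum_eigenvalues_sub_ge (u : OrthonormalBasis ι ℝ E) (v : OrthonormalBasis κ ℝ E)
    {A B : E →ₗ[ℝ] E} (hA : A.IsSymmetric) {a : ι → ℝ} {b : κ → ℝ}
    (hu : ∀ i, A (u i) = a i • u i) (hv : ∀ j, B (v j) = b j • v j) {f : ℝ → ℝ} {d : κ → ℝ}
    {C : ℝ} (hf : ∀ i j, d j * (a i - b j) - C * (a i - b j) ^ 2 ≤ f (a i) - f (b j)) :
    ∑ j, (d j * inner ℝ (v j) ((A - B) (v j)) - C * ‖(A - B) (v j)‖ ^ 2) ≤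
      ∑ i, f (a i) - ∑ j, f (b j) := by
  set w : ι → κ → ℝ := fun i j => inner ℝ (u i) (v j) ^ 2 with hw
  have hw0 (i j) : 0 ≤ w i j := sq_nonneg _
  have hwi (j) : ∑ i, w i j = 1 := by
    have := u.sum_sq_norm_inner_right (v j)
    simpa [hw, sq_abs] using this
  have hwj (i) : ∑ j, w i j = 1 := by
    have := v.sum_sq_norm_inner_left (u i)
    simpa [hw, sq_abs] using this
  have hin (i j) : inner ℝ (u i) ((A - B) (v j)) = (a i - b j) * inner ℝ (u i) (v j) := by
    rw [LinearMap.sub_apply, inner_sub_right, ← hA, hu, hv, real_inner_smul_left,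
      real_inner_smul_right, sub_mul]
  have h1 (j) : inner ℝ (v j) ((A - B) (v j)) = ∑ i, w i j * (a i - b j) := by
    rw [← u.sum_inner_mul_inner]
    refine Finset.sum_congr rfl fun i _ => ?_
    rw [hin, hw, real_inner_comm]
    ring
  have h2 (j) : ‖(A - B) (v j)‖ ^ 2 = ∑ i, w i j * (a i - b j) ^ 2 := by
    rw [← u.sum_sq_norm_inner_right]
    refine Finset.sum_congr rfl fun i _ => ?_
    rw [hin, hw, Real.norm_eq_abs, sq_abs]
    ring
  have h3 : ∑ i, f (a i) = ∑ j, ∑ i, w i j * f (a i) := by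
    rw [Finset.sum_comm]
    simp_rw [← Finset.sum_mul, hwj, one_mul]
  have h4 : ∑ j, f (b j) = ∑ j, ∑ i, w i j * f (b j) := by
    simp_rw [← Finset.sum_mul, hwi, one_mul]
  rw [h3, h4, ← Finset.sum_sub_distrib]
  refine Finset.sum_le_sum fun j _ => ?_
  rw [h1, h2, Finset.mul_sum, Finset.mul_sum, ← Finset.sum_sub_distrib, ← Finset.sum_sub_distrib]
  refine Finset.sum_le_sum fun i _ => ?_
  nlinarith [hw0 i j, hf i j]

/-- A map satisfying a quadratic-error Lipschitz estimate on a convex set is Lipschitz there. -/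
lemma abs_sub_le_of_abs_sub_le_add_sq {s : Set E} (hs : Convex ℝ s) {g : E → ℝ} {L C : ℝ}
    (hg : ∀ x ∈ s, ∀ y ∈ s, |g y - g x| ≤ L * ‖y - x‖ + C * ‖y - x‖ ^ 2) {x y : E}
    (hx : x ∈ s) (hy : y ∈ s) : |g y - g x| ≤ L * ‖y - x‖ := by
  have key (M : ℕ) : |g y - g x| ≤ L * ‖y - x‖ + C * ‖y - x‖ ^ 2 * ((M : ℝ) + 1)⁻¹ := by
    set N : ℕ := M + 1 with hN
    have hN0 : (0 : ℝ) < N := by positivity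
    set p : ℕ → E := fun k => AffineMap.lineMap x y ((k : ℝ) / N) with hp
    have hps (k : ℕ) (hk : k ≤ N) : p k ∈ s := by
      refine hs.lineMap_mem hx hy ⟨by positivity, ?_⟩
      rw [div_le_one hN0]
      exact_mod_cast hk
    have hd (k : ℕ) : ‖p (k + 1) - p k‖ = ‖y - x‖ / N := by
      have : p (k + 1) - p k = (N : ℝ)⁻¹ • (y - x) := by
        simp only [hp, AffineMap.lineMap_apply_module']
        rw [add_sub_add_right_eq_sub, ← sub_smul]
        congr 1
        push_cast
        field_simp
        ring
      rw [this, norm_smul, Real.norm_of_nonneg (by positivity)]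
      ring
    have h0 : p 0 = x := by simp [hp]
    have h1 : p N = y := by simp [hp, hN0.ne']
    calc |g y - g x| = |∑ k ∈ Finset.range N, (g (p (k + 1)) - g (p k))| := by
          rw [Finset.sum_range_sub (fun k => g (p k)), h0, h1]
      _ ≤ ∑ k ∈ Finset.range N, |g (p (k + 1)) - g (p k)| := Finset.abs_sum_le_sum_abs _ _
      _ ≤ ∑ k ∈ Finset.range N, (L * (‖y - x‖ / N) + C * (‖y - x‖ / N) ^ 2) := by
          refine Finset.sum_le_sum fun k hk => ?_
          rw [Finset.mem_range] at hk
          rw [← hd k]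
          exact hg _ (hps k hk.le) _ (hps (k + 1) hk)
      _ = L * ‖y - x‖ + C * ‖y - x‖ ^ 2 * (N : ℝ)⁻¹ := by
          rw [Finset.sum_const, Finset.card_range, nsmul_eq_mul]
          field_simp
      _ = _ := by rw [hN]; push_cast; rfl
  have hlim : Tendsto (fun M : ℕ => L * ‖y - x‖ + C * ‖y - x‖ ^ 2 * ((M : ℝ) + 1)⁻¹) atTop
      (𝓝 (L * ‖y - x‖ + C * ‖y - x‖ ^ 2 * 0)) := by
    refine (tendsto_const_nhds.mul ?_).const_add _
    simpa only [one_div] using tendsto_one_div_add_atTop_nhds_zero_nat (𝕜 := ℝ)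
  simpa using ge_of_tendsto' hlim key

end SpectralPerturbation

section GramMatrix

variable {k b : ℕ}

lemma sum_norm_sq_toEuclideanLin {ι p q : Type*} [Fintype ι] [Fintype p] [Fintype q]
    [DecidableEq q] (M : Matrix p q ℝ) (v : OrthonormalBasis ι ℝ (EuclideanSpace ℝ q)) :
    ∑ j, ‖M.toEuclideanLin (v j)‖ ^ 2 = ∑ i, ∑ k, M i k ^ 2 := by
  simp_rw [EuclideanSpace.real_norm_sq_eq]
  rw [Finset.sum_comm]
  refine Finset.sum_congr rfl fun i _ => ?_
  have h := v.sum_sq_norm_inner_left (WithLp.toLp 2 (M i))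
  rw [EuclideanSpace.real_norm_sq_eq] at h
  rw [← h]
  refine Finset.sum_congr rfl fun j _ => ?_
  rw [Real.norm_eq_abs, sq_abs, Matrix.toLpLin_apply]
  simp [Matrix.mulVec, dotProduct, PiLp.inner_apply, mul_comm]

/-- The space of `k × b` matrices with the Frobenius norm, organized by rows. -/
abbrev RowSpace (k b : ℕ) : Type := PiLp 2 fun _ : Fin k => EuclideanSpace ℝ (Fin b)

/-- The matrix with the given rows. -/
def ofRows (x : RowSpace k b) : Matrix (Fin k) (Fin b) ℝ := Matrix.of fun i μ => x i μ

lemma ofRows_sub (x y : RowSpace k b) : ofRows (x - y) = ofRows x - ofRows y := rfl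

lemma sum_sq_ofRows (x : RowSpace k b) : ∑ i, ∑ μ, ofRows x i μ ^ 2 = ‖x‖ ^ 2 := by
  rw [PiLp.norm_sq_eq_of_L2]
  simp_rw [EuclideanSpace.real_norm_sq_eq]
  rfl

lemma norm_toEuclideanLin_ofRows_le (x : RowSpace k b) (w : EuclideanSpace ℝ (Fin b)) :
    ‖(ofRows x).toEuclideanLin w‖ ≤ ‖x‖ * ‖w‖ := by
  refine le_of_sq_le_sq ?_ (by positivity)
  rw [mul_pow, EuclideanSpace.real_norm_sq_eq, PiLp.norm_sq_eq_of_L2, Finset.sum_mul]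
  refine Finset.sum_le_sum fun i _ => ?_
  rw [← mul_pow, sq_le_sq, abs_of_nonneg (by positivity : 0 ≤ ‖x i‖ * ‖w‖)]
  have h := abs_real_inner_le_norm (x i) w
  rwa [show inner ℝ (x i) w = (ofRows x).toEuclideanLin w i by
    rw [Matrix.toLpLin_apply]
    simp [Matrix.mulVec, dotProduct, PiLp.inner_apply, ofRows, mul_comm]] at h

lemma sum_norm_sq_toEuclideanLin_ofRows_transpose {ι : Type*} [Fintype ι]
    (v : OrthonormalBasis ι ℝ (EuclideanSpace ℝ (Fin k))) (x : RowSpace k b) :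
    ∑ j, ‖(ofRows x)ᵀ.toEuclideanLin (v j)‖ ^ 2 = ‖x‖ ^ 2 := by
  rw [sum_norm_sq_toEuclideanLin, Finset.sum_comm, ← sum_sq_ofRows]
  rfl

lemma norm_toEuclideanLin_ofRows_transpose_le {ι : Type*} [Fintype ι]
    (v : OrthonormalBasis ι ℝ (EuclideanSpace ℝ (Fin k))) (x : RowSpace k b) (j : ι) :
    ‖(ofRows x)ᵀ.toEuclideanLin (v j)‖ ≤ ‖x‖ := by
  refine le_of_sq_le_sq ?_ (norm_nonneg x)
  rw [← sum_norm_sq_toEuclideanLin_ofRows_transpose v x]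
  exact Finset.single_le_sum (f := fun j => ‖(ofRows x)ᵀ.toEuclideanLin (v j)‖ ^ 2)
    (fun i _ => sq_nonneg _) (Finset.mem_univ j)

/-- The affine Gram-type matrix `c x Q xᵀ - s`. -/
def gramMat (Q : Matrix (Fin b) (Fin b) ℝ) (c s : ℝ) (x : RowSpace k b) :
    Matrix (Fin k) (Fin k) ℝ :=
  c • (ofRows x * Q * (ofRows x)ᵀ) - s • 1

lemma isHermitian_gramMat {Q : Matrix (Fin b) (Fin b) ℝ} (hQ : Q.IsHermitian) (c s : ℝ)
    (x : RowSpace k b) : (gramMat Q c s x).IsHermitian := by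
  rw [Matrix.IsHermitian, Matrix.conjTranspose_eq_transpose_of_trivial] at hQ ⊢
  simp [gramMat, Matrix.transpose_mul, hQ, Matrix.mul_assoc]

lemma toEuclideanLin_gramMat_sub (Q : Matrix (Fin b) (Fin b) ℝ) (c s : ℝ) (x y : RowSpace k b) :
    (gramMat Q c s y).toEuclideanLin - (gramMat Q c s x).toEuclideanLin =
      c • ((ofRows (y - x)).toEuclideanLin ∘ₗ Q.toEuclideanLin ∘ₗ (ofRows y)ᵀ.toEuclideanLin +
        (ofRows x).toEuclideanLin ∘ₗ Q.toEuclideanLin ∘ₗ (ofRows (y - x))ᵀ.toEuclideanLin) := by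
  simp only [← Matrix.toLpLin_mul, ← map_sub, ← map_add, ← map_smul]
  congr 1
  simp only [gramMat, ofRows_sub, Matrix.transpose_sub, Matrix.sub_mul, Matrix.mul_sub,
    Matrix.mul_assoc, smul_sub, smul_add]
  abel

/-- The sum of cut-off logarithms of the eigenvalues of `c x Q xᵀ - s`. -/
def gramLogDet (ε : ℝ) (Q : Matrix (Fin b) (Fin b) ℝ) (c s : ℝ) (x : RowSpace k b) : ℝ :=
  ∑ i, lnEps ε (eigs (gramMat Q c s x) i)

variable {Q : Matrix (Fin b) (Fin b) ℝ} {ε c s ℓ R : ℝ}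

lemma gramLogDet_sub_ge (hQ : Q.IsHermitian) (hε : 0 < ε) (hc : 0 ≤ c) (hℓ : 0 ≤ ℓ)
    (hQℓ : ∀ w, ‖Q.toEuclideanLin w‖ ≤ ℓ * ‖w‖) {x y : RowSpace k b} (hx : ‖x‖ ≤ R)
    (hy : ‖y‖ ≤ R) :
    -(ε⁻¹ * (c * ℓ * (2 * R)) * ‖y - x‖ +
      k * (4 / ε ^ 2 * (c * ℓ * (2 * R)) ^ 2) * ‖y - x‖ ^ 2) ≤
      gramLogDet ε Q c s y - gramLogDet ε Q c s x := by
  have hR : 0 ≤ R := (norm_nonneg x).trans hx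
  have hA := isHermitian_gramMat hQ c s y
  have hB := isHermitian_gramMat hQ c s x
  set u := hA.eigenvectorBasis
  set v := hB.eigenvectorBasis
  set A := (gramMat Q c s y).toEuclideanLin
  set B := (gramMat Q c s x).toEuclideanLin
  have hu (i) : A (u i) = hA.eigenvalues i • u i := by
    apply WithLp.ofLp_injective
    rw [Matrix.toLpLin_apply, hA.mulVec_eigenvectorBasis]
    rfl
  have hv (i) : B (v i) = hB.eigenvalues i • v i := by
    apply WithLp.ofLp_injective
    rw [Matrix.toLpLin_apply, hB.mulVec_eigenvectorBasis]
    rfl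
  choose d hd hd' using exists_lnEps_support hε
  have key := sum_eigenvalues_sub_ge u v (Matrix.isSymmetric_toEuclideanLin_iff.2 hA) hu hv
    (f := lnEps ε) (d := fun j => d (hB.eigenvalues j)) (C := 4 / ε ^ 2) fun i j => hd' _ _
  have hsum : gramLogDet ε Q c s y - gramLogDet ε Q c s x =
      ∑ i, lnEps ε (hA.eigenvalues i) - ∑ i, lnEps ε (hB.eigenvalues i) := by
    simp only [gramLogDet, eigs, dif_pos hA, dif_pos hB]
  rw [hsum]
  refine le_trans ?_ key
  set P : RowSpace k b → Fin k → EuclideanSpace ℝ (Fin b) :=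
    fun z j => (ofRows z)ᵀ.toEuclideanLin (v j)
  have hAB (j) : (A - B) (v j) = c • ((ofRows (y - x)).toEuclideanLin (Q.toEuclideanLin (P y j)) +
      (ofRows x).toEuclideanLin (Q.toEuclideanLin (P (y - x) j))) := by
    rw [toEuclideanLin_gramMat_sub]
    rfl
  have hadj (z : RowSpace k b) (j) (w : EuclideanSpace ℝ (Fin b)) :
      inner ℝ (v j) ((ofRows z).toEuclideanLin w) = inner ℝ (P z j) w := by
    have h := Matrix.toEuclideanLin_conjTranspose_eq_adjoint (ofRows z)
    rw [Matrix.conjTranspose_eq_transpose_of_trivial] at h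
    simp only [P]
    rw [h, LinearMap.adjoint_inner_left]
  have hinner (j) : |inner ℝ (v j) ((A - B) (v j))| ≤
      c * ℓ * (‖P (y - x) j‖ * ‖P y j‖ + ‖P x j‖ * ‖P (y - x) j‖) := by
    rw [hAB, real_inner_smul_right, inner_add_right, hadj, hadj, abs_mul, abs_of_nonneg hc,
      mul_assoc]
    gcongr
    refine (abs_add_le _ _).trans ?_
    rw [mul_add]
    gcongr
    · refine (abs_real_inner_le_norm _ _).trans ?_
      calc _ ≤ ‖P (y - x) j‖ * (ℓ * ‖P y j‖) := by gcongr; exact hQℓ _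
        _ = _ := by ring
    · refine (abs_real_inner_le_norm _ _).trans ?_
      calc _ ≤ ‖P x j‖ * (ℓ * ‖P (y - x) j‖) := by gcongr; exact hQℓ _
        _ = _ := by ring
  have hP (z : RowSpace k b) (j) : ‖P z j‖ ≤ ‖z‖ := norm_toEuclideanLin_ofRows_transpose_le v z j
  have hnorm (j) : ‖(A - B) (v j)‖ ≤ c * ℓ * (2 * R) * ‖y - x‖ := by
    rw [hAB, norm_smul, Real.norm_of_nonneg hc]
    calc _ ≤ c * (‖y - x‖ * (ℓ * R) + R * (ℓ * ‖y - x‖)) := by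
          gcongr
          refine (norm_add_le _ _).trans ?_
          gcongr
          · refine (norm_toEuclideanLin_ofRows_le _ _).trans ?_
            gcongr
            refine (hQℓ _).trans ?_
            gcongr
            exact (hP _ _).trans hy
          · refine (norm_toEuclideanLin_ofRows_le _ _).trans ?_
            gcongr
            refine (hQℓ _).trans ?_
            gcongr
            exact hP _ _
      _ = _ := by ring
  have hCS (z w : RowSpace k b) : ∑ j, ‖P z j‖ * ‖P w j‖ ≤ ‖z‖ * ‖w‖ := by
    have h := Real.sum_mul_le_sqrt_mul_sqrt Finset.univ (fun j => ‖P z j‖) fun j => ‖P w j‖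
    rw [sum_norm_sq_toEuclideanLin_ofRows_transpose v z,
      sum_norm_sq_toEuclideanLin_ofRows_transpose v w, Real.sqrt_sq (norm_nonneg _),
      Real.sqrt_sq (norm_nonneg _)] at h
    exact h
  calc _ ≤ ∑ j, (-(ε⁻¹ * (c * ℓ * (‖P (y - x) j‖ * ‖P y j‖ + ‖P x j‖ * ‖P (y - x) j‖))) -
        4 / ε ^ 2 * (c * ℓ * (2 * R) * ‖y - x‖) ^ 2) := by
        rw [Finset.sum_sub_distrib, Finset.sum_const, Finset.card_univ, Fintype.card_fin,
          nsmul_eq_mul, Finset.sum_neg_distrib, ← Finset.mul_sum, ← Finset.mul_sum,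
          Finset.sum_add_distrib]
        have h1 : ε⁻¹ * (c * ℓ * (∑ j, ‖P (y - x) j‖ * ‖P y j‖ + ∑ j, ‖P x j‖ * ‖P (y - x) j‖)) ≤
            ε⁻¹ * (c * ℓ * (‖y - x‖ * R + R * ‖y - x‖)) := by
          gcongr
          · exact (hCS _ _).trans (by gcongr)
          · exact (hCS _ _).trans (by gcongr)
        linarith
    _ ≤ _ := by
        refine Finset.sum_le_sum fun j _ => ?_
        gcongr
        · refine (abs_le.1 ?_).1
          rw [abs_mul]
          exact mul_le_mul (hd _) (hinner j) (abs_nonneg _) (by positivity)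
        · exact hnorm j

lemma abs_gramLogDet_sub_le (hQ : Q.IsHermitian) (hε : 0 < ε) (hc : 0 ≤ c) (hℓ : 0 ≤ ℓ)
    (hQℓ : ∀ w, ‖Q.toEuclideanLin w‖ ≤ ℓ * ‖w‖) {x y : RowSpace k b} (hx : ‖x‖ ≤ R)
    (hy : ‖y‖ ≤ R) :
    |gramLogDet ε Q c s y - gramLogDet ε Q c s x| ≤ ε⁻¹ * (c * ℓ * (2 * R)) * ‖y - x‖ := by
  refine abs_sub_le_of_abs_sub_le_add_sq (convex_closedBall (0 : RowSpace k b) R)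
    (C := k * (4 / ε ^ 2 * (c * ℓ * (2 * R)) ^ 2)) (fun x hx y hy => ?_)
    (mem_closedBall_zero_iff.2 hx) (mem_closedBall_zero_iff.2 hy)
  rw [mem_closedBall_zero_iff] at hx hy
  have h1 := gramLogDet_sub_ge (s := s) hQ hε hc hℓ hQℓ hx hy
  have h2 := gramLogDet_sub_ge (s := s) hQ hε hc hℓ hQℓ hy hx
  rw [norm_sub_rev] at h2
  exact abs_le.2 ⟨h1, by linarith⟩

lemma continuous_gramLogDet (hQ : Q.IsHermitian) (hε : 0 < ε) (hc : 0 ≤ c) (hℓ : 0 ≤ ℓ)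
    (hQℓ : ∀ w, ‖Q.toEuclideanLin w‖ ≤ ℓ * ‖w‖) :
    Continuous (gramLogDet ε Q c s : RowSpace k b → ℝ) := by
  refine continuous_iff_continuousAt.2 fun x => ?_
  have hlip : LipschitzOnWith (ε⁻¹ * (c * ℓ * (2 * (‖x‖ + 1)))).toNNReal
      (gramLogDet ε Q c s : RowSpace k b → ℝ) (Metric.closedBall 0 (‖x‖ + 1)) := by
    refine .of_dist_le_mul fun y hy z hz => ?_
    rw [mem_closedBall_zero_iff] at hy hz
    rw [Real.coe_toNNReal _ (by positivity), Real.dist_eq, dist_eq_norm]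
    exact abs_gramLogDet_sub_le hQ hε hc hℓ hQℓ hz hy
  refine hlip.continuousOn.continuousAt (Metric.closedBall_mem_nhds_of_mem ?_)
  simp

end GramMatrix
section TruncatedGaussianMatrix

variable {k b : ℕ}

/-- Reorganize a family of entries as a point of the space of rows. -/
def toRows (z : Fin k → Fin b → ℝ) : RowSpace k b := WithLp.toLp 2 fun i => WithLp.toLp 2 (z i)

@[fun_prop]
lemma continuous_toRows : Continuous (toRows : (Fin k → Fin b → ℝ) → RowSpace k b) := by
  unfold toRows
  fun_prop

lemma map_toRows_gaussMat :
    (gaussMat k b).map toRows = stdGaussian (RowSpace k b) := by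
  have h : (gaussMat k b).map toRows =
      (Measure.pi fun _ : Fin k => stdGaussian (EuclideanSpace ℝ (Fin b))).map (WithLp.toLp 2) := by
    have h1 := Measure.pi_map_pi (μ := fun _ : Fin k => Measure.pi fun _ : Fin b => stdGauss)
      (f := fun _ => WithLp.toLp 2) (Y := fun _ => EuclideanSpace ℝ (Fin b))
      (hμ := fun _ => by rw [map_pi_eq_stdGaussian]; infer_instance) fun _ => by fun_prop
    simp_rw [map_pi_eq_stdGaussian] at h1
    rw [← h1, Measure.map_map (by fun_prop) (by fun_prop)]
    rfl
  rw [h]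
  have : IsProbabilityMeasure
      ((Measure.pi fun _ : Fin k => stdGaussian (EuclideanSpace ℝ (Fin b))).map
        (WithLp.toLp 2)) := Measure.isProbabilityMeasure_map (by fun_prop)
  refine Measure.ext_of_charFun (E := RowSpace k b) ?_
  ext t
  simp_rw [charFun_pi, charFun_stdGaussian, ← Complex.exp_sum, ← Complex.ofReal_pow,
    PiLp.norm_sq_eq_of_L2]
  simp [Finset.sum_div, neg_div]

lemma measure_abs_sub_integral_map {α β : Type*} [MeasurableSpace α] [MeasurableSpace β]
    {μ : Measure α} {f : α → β} (hf : Measurable f) {g : β → ℝ} (hg : Measurable g) (r : ℝ) :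
    (μ.map f) {z | r ≤ |g z - ∫ w, g w ∂(μ.map f)|} =
      μ {x | r ≤ |g (f x) - ∫ w, g (f w) ∂μ|} := by
  rw [integral_map hf.aemeasurable hg.aestronglyMeasurable, Measure.map_apply hf]
  · rfl
  · exact measurableSet_le measurable_const (hg.sub_const _).abs

lemma map_entrywise_gaussMat_congr {f g : ℝ → ℝ} (hf : Measurable f) (hg : Measurable g)
    (hfg : stdGauss.map f = stdGauss.map g) :
    (gaussMat k b).map (fun z i μ => f (z i μ)) = (gaussMat k b).map (fun z i μ => g (z i μ)) := by
  have key {h : ℝ → ℝ} (hh : Measurable h) : (gaussMat k b).map (fun z i μ => h (z i μ)) =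
      Measure.pi fun _ => Measure.pi fun _ => stdGauss.map h := by
    have := Measure.isProbabilityMeasure_map (μ := stdGauss) hh.aemeasurable
    have h1 : (Measure.pi fun _ : Fin b => stdGauss).map (fun z μ => h (z μ)) =
        Measure.pi fun _ => stdGauss.map h :=
      Measure.pi_map_pi (f := fun _ => h) fun _ => hh.aemeasurable
    have h2 := Measure.pi_map_pi (μ := fun _ : Fin k => Measure.pi fun _ : Fin b => stdGauss)
      (f := fun _ z μ => h (z μ)) (hμ := fun _ => by rw [h1]; infer_instance)
      fun _ => (measurable_pi_lambda _ fun μ => hh.comp (measurable_pi_apply μ)).aemeasurable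
    simp_rw [h1] at h2
    exact h2
  rw [key hf, key hg, hfg]

lemma norm_toRows_le {z : Fin k → Fin b → ℝ} {c : ℝ} (hz : ∀ i μ, |z i μ| ≤ c) :
    ‖toRows z‖ ≤ √(k * b) * |c| := by
  refine le_of_sq_le_sq ?_ (by positivity)
  rw [mul_pow, Real.sq_sqrt (by positivity), ← sum_sq_ofRows]
  calc ∑ i, ∑ μ, ofRows (toRows z) i μ ^ 2 ≤ ∑ _i : Fin k, ∑ _μ : Fin b, |c| ^ 2 := by
        refine Finset.sum_le_sum fun i _ => Finset.sum_le_sum fun μ _ => ?_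
        rw [sq_le_sq, abs_abs]
        exact (hz i μ).trans (le_abs_self c)
    _ = _ := by simp [mul_assoc]

lemma norm_toRows_sub_le {z w : Fin k → Fin b → ℝ} {x y : RowSpace k b} {ρ : ℝ} (hρ : 0 ≤ ρ)
    (h : ∀ i μ, |z i μ - w i μ| ≤ ρ * |x i μ - y i μ|) :
    ‖toRows z - toRows w‖ ≤ ρ * ‖x - y‖ := by
  refine le_of_sq_le_sq ?_ (by positivity)
  rw [mul_pow, ← sum_sq_ofRows, ← sum_sq_ofRows, Finset.mul_sum]
  refine Finset.sum_le_sum fun i _ => ?_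
  rw [Finset.mul_sum]
  refine Finset.sum_le_sum fun μ _ => ?_
  rw [← mul_pow, sq_le_sq, abs_mul, abs_of_nonneg hρ]
  exact h i μ

/-- Concentration of locally Lipschitz functions of a matrix with truncated Gaussian entries. -/
lemma measure_gaussMat_hardCut_abs_sub_integral_ge_le {c σ L : ℝ} {K : ℝ≥0} (hc : 0 < c)
    (hσ : 0 < σ) {G : RowSpace k b → ℝ} (hGc : Continuous G)
    (hG : ∀ x y, ‖x‖ ≤ √(k * b) * (c / σ) → ‖y‖ ≤ √(k * b) * (c / σ) →
      |G x - G y| ≤ L * ‖x - y‖) (hL : 0 ≤ L) (hLK : L / σ ≤ K) {r : ℝ} (hr : 0 ≤ r) :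
    gaussMat k b {z | r ≤ |G (toRows fun i μ => hardCut c (z i μ) / σ) -
        ∫ w, G (toRows fun i μ => hardCut c (w i μ) / σ) ∂(gaussMat k b)|} ≤
      ENNReal.ofReal (2 * Real.exp (-r ^ 2 / (2 * (π ^ 2 / 4 * K ^ 2)))) := by
  obtain ⟨T, hT, hTc, hTmap⟩ := exists_lipschitz_map_eq_hardCut hc
  have hTm := hT.continuous.measurable
  have hhm := measurable_hardCut c
  have hΦ : Measurable fun z : Fin k → Fin b → ℝ => G (toRows fun i μ => z i μ / σ) := by
    refine Continuous.measurable ?_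
    fun_prop
  have hTlip : LipschitzWith K fun x : RowSpace k b => G (toRows fun i μ => T (x i μ) / σ) := by
    refine .of_dist_le_mul fun x y => ?_
    have hR (x : RowSpace k b) : ‖toRows fun i μ => T (x i μ) / σ‖ ≤ √(k * b) * (c / σ) := by
      have h := norm_toRows_le (z := fun i μ => T (x i μ) / σ) (c := c / σ) fun i μ => by
        rw [abs_div, abs_of_pos hσ]
        gcongr
        exact hTc _
      rwa [abs_of_pos (by positivity)] at h
    have h1 := norm_toRows_sub_le (z := fun i μ => T (x i μ) / σ) (w := fun i μ => T (y i μ) / σ)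
      (x := x) (y := y) (ρ := σ⁻¹) (by positivity) fun i μ => by
        have := hT.dist_le_mul (x i μ) (y i μ)
        rw [Real.dist_eq, Real.dist_eq, NNReal.coe_one, one_mul] at this
        rw [← sub_div, abs_div, abs_of_pos hσ, div_eq_inv_mul]
        gcongr
    rw [Real.dist_eq, dist_eq_norm]
    calc _ ≤ L * (σ⁻¹ * ‖x - y‖) := (hG _ _ (hR x) (hR y)).trans (by gcongr)
      _ = L / σ * ‖x - y‖ := by ring
      _ ≤ _ := by gcongr
  have hmain := hTlip.measure_stdGaussian_abs_sub_integral_ge_le hr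
  rw [← map_toRows_gaussMat, measure_abs_sub_integral_map (by fun_prop)
    hTlip.continuous.measurable] at hmain
  have h1 := measure_abs_sub_integral_map (μ := gaussMat k b)
    (f := fun z i μ => hardCut c (z i μ)) (by fun_prop) hΦ r
  have h2 := measure_abs_sub_integral_map (μ := gaussMat k b)
    (f := fun z i μ => T (z i μ)) (by fun_prop) hΦ r
  rw [← h1, ← map_entrywise_gaussMat_congr hTm hhm hTmap, h2]
  exact hmain

end TruncatedGaussianMatrix

section TruncationNormalizer

lemma integrable_sq_stdGauss : Integrable (fun x : ℝ => x ^ 2) stdGauss :=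
  (memLp_id_gaussianReal 2).integrable_sq

lemma truncNorm_mono : Monotone truncNorm := fun c c' hcc => by
  refine setIntegral_mono_set integrable_sq_stdGauss.integrableOn
    (.of_forall fun x => sq_nonneg x) (.of_forall fun x hx => ?_)
  exact le_trans hx hcc

lemma truncNorm_pos {c : ℝ} (hc : 0 < c) : 0 < truncNorm c := by
  rw [truncNorm, setIntegral_pos_iff_support_of_nonneg_ae (.of_forall fun x => sq_nonneg x)
    integrable_sq_stdGauss.integrableOn]
  have hsub : Ioc 0 c ⊆ (Function.support fun x : ℝ => x ^ 2) ∩ {x | |x| ≤ c} := fun x hx =>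
    ⟨pow_ne_zero 2 hx.1.ne', abs_le.2 ⟨by linarith [hx.1], hx.2⟩⟩
  refine lt_of_lt_of_le ?_ (measure_mono hsub)
  have h := strictMono_cdf_stdGauss hc
  rw [cdf_eq_real, cdf_eq_real, ← sub_pos,
    ← measureReal_sdiff (Iic_subset_Iic.2 hc.le) measurableSet_Iic,
    show Iic c \ Iic 0 = Ioc 0 c by ext; simp [and_comm]] at h
  exact (ENNReal.toReal_pos_iff.1 h).1

end TruncationNormalizer

section ProjectedHessian

variable {φ : ℝ → ℝ} {n m : ℕ} (y : Fin m → ℝ)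

lemma transpose_Pperp : (Pperp φ y)ᵀ = Pperp φ y := by
  ext i j
  simp [Pperp, Matrix.one_apply, eq_comm, mul_comm]

lemma isHermitian_Lam : (Lam φ n y).IsHermitian := by
  rw [Matrix.IsHermitian, Matrix.conjTranspose_eq_transpose_of_trivial, Lam,
    Matrix.transpose_mul, Matrix.transpose_mul, transpose_Pperp, Dmat,
    Matrix.diagonal_transpose, Matrix.mul_assoc]

lemma norm_toEuclideanLin_Pperp_le (w : EuclideanSpace ℝ (Fin m)) :
    ‖(Pperp φ y).toEuclideanLin w‖ ≤ ‖w‖ := by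
  set p : EuclideanSpace ℝ (Fin m) := WithLp.toLp 2 fun μ => deriv φ (y μ) with hp
  have hpn : ∑ ρ, deriv φ (y ρ) ^ 2 = ‖p‖ ^ 2 := by rw [EuclideanSpace.real_norm_sq_eq]
  have h : (Pperp φ y).toEuclideanLin w = w - (inner ℝ p w / ‖p‖ ^ 2) • p := by
    ext i
    rw [Matrix.toLpLin_apply, Pperp, hpn, Matrix.sub_mulVec, Matrix.one_mulVec]
    simp only [Matrix.mulVec, dotProduct, PiLp.inner_apply, Matrix.of_apply, PiLp.sub_apply,
      PiLp.smul_apply, Pi.sub_apply, smul_eq_mul, Finset.sum_div, Finset.sum_mul]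
    congr 1
    refine Finset.sum_congr rfl fun j _ => ?_
    simp [hp]
    ring
  refine le_of_sq_le_sq ?_ (norm_nonneg w)
  rw [h, norm_sub_sq_real, norm_smul, mul_pow, Real.norm_eq_abs, sq_abs, real_inner_smul_right,
    real_inner_comm w p]
  rcases eq_or_ne ‖p‖ 0 with h0 | h0
  · simp [h0]
  · have : 0 ≤ inner ℝ w p ^ 2 / ‖p‖ ^ 2 := by positivity
    have e1 : inner ℝ w p / ‖p‖ ^ 2 * inner ℝ w p = inner ℝ w p ^ 2 / ‖p‖ ^ 2 := by ring
    have e2 : (inner ℝ w p / ‖p‖ ^ 2) ^ 2 * ‖p‖ ^ 2 = inner ℝ w p ^ 2 / ‖p‖ ^ 2 := by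
      field_simp
    linarith

lemma norm_toEuclideanLin_diagonal_le {d : Fin m → ℝ} {ℓ : ℝ} (hd : ∀ μ, |d μ| ≤ ℓ) (hℓ : 0 ≤ ℓ)
    (w : EuclideanSpace ℝ (Fin m)) : ‖(Matrix.diagonal d).toEuclideanLin w‖ ≤ ℓ * ‖w‖ := by
  refine le_of_sq_le_sq ?_ (by positivity)
  rw [mul_pow, EuclideanSpace.real_norm_sq_eq, EuclideanSpace.real_norm_sq_eq, Finset.mul_sum]
  refine Finset.sum_le_sum fun i _ => ?_
  rw [Matrix.toLpLin_apply]
  change (Matrix.diagonal d *ᵥ w.ofLp) i ^ 2 ≤ _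
  rw [Matrix.mulVec_diagonal, mul_pow]
  exact mul_le_mul_of_nonneg_right (sq_le_sq.2 ((hd i).trans (le_abs_self ℓ))) (sq_nonneg _)

lemma norm_toEuclideanLin_Lam_le {K : ℝ} (hK : ∀ x, |deriv (deriv φ) x| ≤ K)
    (w : EuclideanSpace ℝ (Fin m)) :
    ‖(Lam φ n y).toEuclideanLin w‖ ≤ n / m * K * ‖w‖ := by
  have hK0 : 0 ≤ K := (abs_nonneg _).trans (hK 0)
  rw [Lam, Matrix.mul_assoc, Matrix.toLpLin_mul 2 2 2, Matrix.toLpLin_mul 2 2 2]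
  refine (norm_toEuclideanLin_Pperp_le y _).trans ?_
  refine (norm_toEuclideanLin_diagonal_le (ℓ := n / m * K) (fun μ => ?_) (by positivity) _).trans ?_
  · rw [abs_mul, abs_of_nonneg (by positivity)]
    gcongr
    exact hK _
  · gcongr
    exact norm_toEuclideanLin_Pperp_le y _

lemma cutoffLogDet_eq_gramLogDet (γ δ : ℝ) (z : Fin (n - 1) → Fin m → ℝ) :
    cutoffLogDet φ n γ δ y z =
      gramLogDet ((n : ℝ) ^ (-δ)) (Lam φ n y) (n : ℝ)⁻¹ (1 / (m : ℝ) * ∑ μ, y μ * deriv φ (y μ))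
        (toRows fun i μ => hardCut ((n : ℝ) ^ (γ / 2)) (z i μ) /
          √(truncNorm ((n : ℝ) ^ (γ / 2)))) := rfl

end ProjectedHessian

theorem concentration_cutoff_logdet
    (φ : ℝ → ℝ) (hφ : ContDiff ℝ 3 φ)
    (hbd : ∃ K : ℝ, ∀ x : ℝ, |x * deriv φ x| ≤ K ∧ |deriv (deriv φ) x| ≤ K)
    (α : ℝ) (hα : 1 < α)
    (m : ℕ → ℕ) (hm : Tendsto (fun n => (m n : ℝ) / n) atTop (𝓝 α))
    (γ δ : ℝ) (hγ : γ ∈ Ioo (0 : ℝ) (1 / 2)) (hδ : δ ∈ Ioo (0 : ℝ) 1)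
    (hγδ : γ + 2 * δ < 1) :
    ∃ K₁ > (0 : ℝ), ∃ K₂ > (0 : ℝ),
      ∀ (n : ℕ) (y : Fin (m n) → ℝ), ∀ t > (0 : ℝ),
        (gaussMat (n - 1) (m n))
            {z | t ≤ (1 / (n : ℝ)) * |cutoffLogDet φ n γ δ y z -
                ∫ z', cutoffLogDet φ n γ δ y z' ∂(gaussMat (n - 1) (m n))|}
          ≤ ENNReal.ofReal
              (K₁ * Real.exp (-K₂ * (n : ℝ) ^ ((2 : ℝ) - γ - 2 * δ) * t ^ 2)) := by
  obtain ⟨K, hK⟩ := hbd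
  have hK0 : 0 ≤ K := (abs_nonneg _).trans (hK 0).2
  obtain ⟨B, hB⟩ : ∃ B : ℝ, ∀ n : ℕ, (n : ℝ) / m n ≤ B := by
    have h : Tendsto (fun n : ℕ => (n : ℝ) / m n) atTop (𝓝 α⁻¹) := by
      simpa only [inv_div] using hm.inv₀ (by linarith)
    obtain ⟨B, hB⟩ := h.bddAbove_range
    exact ⟨B, fun n => hB (mem_range_self n)⟩
  have hB0 : 0 ≤ B := (by positivity : (0 : ℝ) ≤ (0 : ℕ) / m 0).trans (hB 0)
  have hτ := truncNorm_pos one_pos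
  set κ : ℝ := 2 * (K + 1) * √B / truncNorm 1 + 1 with hκ
  have hκ0 : 0 < κ := by positivity
  refine ⟨2, two_pos, 2 / (π ^ 2 * κ ^ 2), by positivity, fun n y t ht => ?_⟩
  rcases Nat.eq_zero_or_pos n with rfl | hn
  · simp [not_le.2 ht]
  have hn0 : (0 : ℝ) < n := by exact_mod_cast hn
  set c : ℝ := (n : ℝ) ^ (γ / 2) with hc
  set ε : ℝ := (n : ℝ) ^ (-δ) with hε
  have hc0 : 0 < c := by positivity
  have hε0 : 0 < ε := by positivity
  have hc1 : 1 ≤ c := Real.one_le_rpow (by exact_mod_cast hn) (by linarith [hγ.1])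
  have hτc : truncNorm 1 ≤ truncNorm c := truncNorm_mono hc1
  set σ : ℝ := √(truncNorm c) with hσ
  have hσ0 : 0 < σ := Real.sqrt_pos.2 (hτ.trans_le hτc)
  have hσ2 : σ ^ 2 = truncNorm c := Real.sq_sqrt (hτ.trans_le hτc).le
  set s : ℝ := 1 / (m n : ℝ) * ∑ μ, y μ * deriv φ (y μ)
  set R : ℝ := √(((n - 1 : ℕ) : ℝ) * m n) * (c / σ) with hR
  set ℓ : ℝ := n / m n * K with hℓ
  have hℓ0 : 0 ≤ ℓ := by positivity
  have hQ := isHermitian_Lam (φ := φ) (n := n) y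
  have hQℓ := norm_toEuclideanLin_Lam_le (n := n) y fun x => (hK x).2
  set L : ℝ := ε⁻¹ * ((n : ℝ)⁻¹ * ℓ * (2 * R)) with hL
  have hL0 : 0 ≤ L := by positivity
  have hLκ : L / σ ≤ κ * (n : ℝ) ^ (δ + γ / 2) := by
    have hroot : (n : ℝ)⁻¹ * (n / m n) * √(((n - 1 : ℕ) : ℝ) * m n) ≤ √B := by
      refine Real.le_sqrt_of_sq_le ?_
      rw [mul_pow, Real.sq_sqrt (by positivity)]
      refine le_trans ?_ (hB n)
      rcases Nat.eq_zero_or_pos (m n) with h0 | h0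
      · simp [h0]
      have hm0 : (0 : ℝ) < m n := by exact_mod_cast h0
      have hn1 : ((n - 1 : ℕ) : ℝ) ≤ n := by exact_mod_cast Nat.sub_le n 1
      calc ((n : ℝ)⁻¹ * (n / m n)) ^ 2 * (((n - 1 : ℕ) : ℝ) * m n)
          = ((n - 1 : ℕ) : ℝ) / m n := by field_simp
        _ ≤ n / m n := by gcongr
    have hpow : ε⁻¹ * c = (n : ℝ) ^ (δ + γ / 2) := by
      rw [hε, hc, ← Real.rpow_neg hn0.le, neg_neg, ← Real.rpow_add hn0]
    calc L / σ = 2 * K * ((n : ℝ)⁻¹ * (n / m n) * √(((n - 1 : ℕ) : ℝ) * m n)) / σ ^ 2 *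
          (ε⁻¹ * c) := by rw [hL, hℓ, hR]; field_simp
      _ ≤ 2 * (K + 1) * √B / truncNorm 1 * (ε⁻¹ * c) := by
          rw [hσ2]
          gcongr
          linarith
      _ ≤ κ * (ε⁻¹ * c) := by
          gcongr
          linarith
      _ = _ := by rw [hpow]
  have hmain := measure_gaussMat_hardCut_abs_sub_integral_ge_le (k := n - 1) (b := m n)
    (K := (κ * (n : ℝ) ^ (δ + γ / 2)).toNNReal) hc0 hσ0
    (continuous_gramLogDet (s := s) hQ hε0 (by positivity : (0 : ℝ) ≤ (n : ℝ)⁻¹) hℓ0 hQℓ)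
    (fun x z hx hz => abs_gramLogDet_sub_le hQ hε0 (by positivity) hℓ0 hQℓ hz hx) hL0
    (hLκ.trans (Real.le_coe_toNNReal _))
    (by positivity : 0 ≤ n * t)
  have hexp : -(n * t) ^ 2 / (2 * (π ^ 2 / 4 * (κ * (n : ℝ) ^ (δ + γ / 2)) ^ 2)) =
      -(2 / (π ^ 2 * κ ^ 2)) * (n : ℝ) ^ ((2 : ℝ) - γ - 2 * δ) * t ^ 2 := by
    have h1 : (n : ℝ) ^ ((2 : ℝ) - γ - 2 * δ) = n ^ 2 / ((n : ℝ) ^ (δ + γ / 2)) ^ 2 := by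
      rw [← Real.rpow_natCast ((n : ℝ) ^ (δ + γ / 2)), ← Real.rpow_mul hn0.le,
        ← Real.rpow_natCast (n : ℝ), ← Real.rpow_sub hn0]
      congr 1
      push_cast
      ring
    rw [h1]
    field_simp
    ring
  rw [Real.coe_toNNReal _ (by positivity), hexp] at hmain
  refine (measure_mono fun z hz => ?_).trans hmain
  rw [Set.mem_ofPred_eq, one_div, inv_mul_eq_div, le_div_iff₀ hn0, mul_comm t] at hz
  simp_rw [cutoffLogDet_eq_gramLogDet] at hz
  exact hz
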